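/- Suppose α ≠ 0 and (α+β)(6α+β)(16α+β) ≠ 0. Then the presented Lie algebra 𝔥(α,β) is isomorphic to the direct sum sl₂(K) ⊕ K³ of the 3-dimensional simple Lie algebra sl₂(K) and the 3-dimensional abelian Lie algebra K³. Moreover, under this isomorphism the images in 𝔥(α,β) of E₁ = [A₀,A₁], E₂ = [A₀,[A₀,A₁]], E₃ = [A₁,[A₀,A₁]] span the summand sl₂(K), and the images of Y, Z₀ = −4αA₀ + [A₀,[A₀,A₁]], Z₁ = 4αA₁ + [A₁,[A₀,A₁]] span the abelian summand K³. -/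

import Mathlib

noncomputable section

variable (K : Type*) [Field K] [CharZero K]

/-- Generators of the free Lie algebra on three generators `A₀, A₁, Y`. -/
def genA₀ : FreeLieAlgebra K (Fin 3) := FreeLieAlgebra.of K 0
def genA₁ : FreeLieAlgebra K (Fin 3) := FreeLieAlgebra.of K 1
def genY : FreeLieAlgebra K (Fin 3) := FreeLieAlgebra.of K 2

variable (α β : K)

/-- The left-hand sides of the relations (R1)–(R6). -/
def weRelations : Set (FreeLieAlgebra K (Fin 3)) :=
  { ⁅genA₁ K, ⁅genA₁ K, ⁅genA₀ K, genA₁ K⁆⁆⁆,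
    (4 * α) • ⁅genA₀ K, genA₁ K⁆ + ⁅genA₀ K, ⁅genA₁ K, ⁅genA₀ K, genA₁ K⁆⁆⁆,
    ⁅genA₁ K, ⁅genA₁ K, ⁅genA₀ K, ⁅genA₀ K, ⁅genA₀ K, genA₁ K⁆⁆⁆⁆⁆,
    ⁅genA₁ K, ⁅genA₀ K, ⁅genA₀ K, ⁅genA₀ K, ⁅genA₀ K, genA₁ K⁆⁆⁆⁆⁆
      - β • ⁅genA₀ K, ⁅genA₀ K, ⁅genA₀ K, genA₁ K⁆⁆⁆
      + ((1 : K) / 2) • ⁅genA₀ K, ⁅genA₁ K, ⁅genA₀ K, ⁅genA₀ K, ⁅genA₀ K, genA₁ K⁆⁆⁆⁆⁆,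
    ⁅genA₁ K, genY K⁆ + ⁅genA₀ K, ⁅genA₀ K, ⁅genA₀ K, ⁅genA₀ K, ⁅genA₀ K, genA₁ K⁆⁆⁆⁆⁆,
    ⁅genA₀ K, genY K⁆ }

/-- The Lie ideal of the free Lie algebra generated by the relations (R1)–(R6). -/
def weIdeal : LieIdeal K (FreeLieAlgebra K (Fin 3)) :=
  LieSubmodule.lieSpan K (FreeLieAlgebra K (Fin 3)) (weRelations K α β)

/-- The Wahlquist–Estabrook prolongation algebra `𝔥(α,β)`, presented by generators
`A₀, A₁, Y` and relations (R1)–(R6). -/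
abbrev WEAlgebra := FreeLieAlgebra K (Fin 3) ⧸ weIdeal K α β

/-- The image of a free Lie algebra element in `𝔥(α,β)`. -/
def wePr : FreeLieAlgebra K (Fin 3) → WEAlgebra K α β :=
  LieSubmodule.Quotient.mk (N := weIdeal K α β)

/-- Core computation: the relations force `[A₀,[A₀,[A₀,A₁]]] = 0`. -/
theorem weX_zero {K L : Type*} [Field K] [CharZero K] [LieRing L] [LieAlgebra K L]
    (α l : K) (h1 : 8 * α - l ≠ 0) (h2 : 4 * α - l ≠ 0) (h3 : 2 * α - l ≠ 0)
    (A B Y E E2 E3 X U : L) (dE : ⁅A, B⁆ = E) (dE2 : ⁅A, E⁆ = E2) (dE3 : ⁅B, E⁆ = E3)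
    (dX : ⁅A, E2⁆ = X) (dU : ⁅B, X⁆ = U)
    (r1 : ⁅B, E3⁆ = 0) (r2 : (4 * α) • E + ⁅A, E3⁆ = 0) (r3 : ⁅B, U⁆ = 0)
    (r4 : ⁅B, ⁅A, X⁆⁆ - (4 * α - 5 / 2 * l) • X + ((1 : K) / 2) • ⁅A, U⁆ = 0)
    (r5 : ⁅B, Y⁆ + ⁅A, ⁅A, X⁆⁆ = 0) (r6 : ⁅A, Y⁆ = 0) : X = 0 := by
  have e1 : ∀ m : L, ⁅E, m⁆ = ⁅A, ⁅B, m⁆⁆ - ⁅B, ⁅A, m⁆⁆ := fun m => by rw [← dE, lie_lie]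
  have e2 : ∀ m : L, ⁅E2, m⁆ = ⁅A, ⁅E, m⁆⁆ - ⁅E, ⁅A, m⁆⁆ := fun m => by rw [← dE2, lie_lie]
  have e3 : ∀ m : L, ⁅E3, m⁆ = ⁅B, ⁅E, m⁆⁆ - ⁅E, ⁅B, m⁆⁆ := fun m => by rw [← dE3, lie_lie]
  have ex : ∀ m : L, ⁅X, m⁆ = ⁅A, ⁅E2, m⁆⁆ - ⁅E2, ⁅A, m⁆⁆ := fun m => by rw [← dX, lie_lie]
  have eu : ∀ m : L, ⁅U, m⁆ = ⁅B, ⁅X, m⁆⁆ - ⁅X, ⁅B, m⁆⁆ := fun m => by rw [← dU, lie_lie]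
  -- `Ba m : b (a m) = a (b m) - e1 m`
  have Ba : ∀ m : L, ⁅B, ⁅A, m⁆⁆ = ⁅A, ⁅B, m⁆⁆ - ⁅E, m⁆ := fun m => by rw [e1]; abel
  have EA : ∀ m : L, ⁅E, ⁅A, m⁆⁆ = ⁅A, ⁅E, m⁆⁆ - ⁅E2, m⁆ := fun m => by rw [e2]; abel
  have EB : ∀ m : L, ⁅E, ⁅B, m⁆⁆ = ⁅B, ⁅E, m⁆⁆ - ⁅E3, m⁆ := fun m => by rw [e3]; abel
  have AE3 : ⁅A, E3⁆ = -(4 * α) • E := by linear_combination (norm := module) r2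
  have BE2 : ⁅B, E2⁆ = -(4 * α) • E := by
    rw [← dE2, Ba, dE3, AE3, lie_self, sub_zero]
  have EE2 : ⁅E, E2⁆ = -(4 * α) • E2 - U := by
    rw [e1, BE2, dX, dU, lie_smul, dE2]
  have EA' : ⁅E, A⁆ = - E2 := by rw [← lie_skew, dE2]
  -- `Z₁` commutes with `A` and `B`
  have Z1A : ⁅(4 * α) • B + E3, A⁆ = 0 := by
    rw [← lie_skew, lie_add, lie_smul, dE, AE3]; module
  have Z1B : ⁅(4 * α) • B + E3, B⁆ = 0 := by
    rw [← lie_skew, lie_add, lie_smul, lie_self, r1]; simp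
  have z1a : ∀ m : L, ⁅(4 * α) • B + E3, m⁆ = 0 → ⁅(4 * α) • B + E3, ⁅A, m⁆⁆ = 0 := fun m hm => by
    rw [leibniz_lie, Z1A, hm]; simp
  have Z1E := z1a _ Z1B
  rw [dE] at Z1E
  have Z1E2 := z1a _ Z1E
  rw [dE2] at Z1E2
  have Z1X := z1a _ Z1E2
  rw [dX] at Z1X
  have Z1X2 := z1a _ (z1a _ Z1X)
  have red : ∀ m : L, ⁅(4 * α) • B + E3, m⁆ = 0 → ⁅E3, m⁆ = -(4 * α) • ⁅B, m⁆ := fun m hm => by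
    rw [add_lie, smul_lie] at hm
    linear_combination (norm := module) hm
  -- weights
  have EX1 : ⁅E, X⁆ = -(4 * α) • X - ⁅A, U⁆ := by
    rw [← dX, EA, EE2, lie_self, lie_sub, lie_smul, dX]; module
  have AU : ⁅A, U⁆ = -l • X := by
    rw [Ba, dU, EX1] at r4
    linear_combination (norm := module) (2 / 5 : K) • r4
  have EX : ⁅E, X⁆ = (l - 4 * α) • X := by rw [EX1, AU]; module
  have EU : ⁅E, U⁆ = l • U := by
    rw [e1, r3, lie_zero, AU, lie_smul, dU]; module
  -- `V = [Z₀, X]`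
  obtain ⟨V, hV⟩ : ∃ V, V = ⁅E2, X⁆ - (4 * α) • ⁅A, X⁆ := ⟨_, rfl⟩
  have E2X : ⁅E2, X⁆ = (4 * α) • ⁅A, X⁆ + V := by rw [hV]; module
  have BX1 : ⁅B, ⁅A, X⁆⁆ = (4 * α - 2 * l) • X := by
    rw [Ba, dU, AU, EX]; module
  have EX1' : ⁅E, ⁅A, X⁆⁆ = (l - 8 * α) • ⁅A, X⁆ - V := by
    rw [EA, EX, lie_smul, E2X]; module
  have BX2 : ⁅B, ⁅A, ⁅A, X⁆⁆⁆ = (12 * α - 3 * l) • ⁅A, X⁆ + V := by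
    rw [Ba, BX1, EX1', lie_smul]; module
  have E2X1 : ⁅E2, ⁅A, X⁆⁆ = (4 * α) • ⁅A, ⁅A, X⁆⁆ + ⁅A, V⁆ := by
    have := ex X
    rw [lie_self, E2X, lie_add, lie_smul] at this
    linear_combination (norm := module) this
  have EX2 : ⁅E, ⁅A, ⁅A, X⁆⁆⁆ = (l - 12 * α) • ⁅A, ⁅A, X⁆⁆ - (2 : K) • ⁅A, V⁆ := by
    rw [EA, EX1', E2X1, lie_sub, lie_smul]; module
  have E2U : ⁅E2, U⁆ = -(4 * α * l) • X := by
    rw [e2, EU, AU, lie_smul, lie_smul, AU, EX]; module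
  have BV : ⁅B, V⁆ = 0 := by
    have h : ⁅B, ⁅E2, X⁆⁆ = ⁅⁅B, E2⁆, X⁆ + ⁅E2, ⁅B, X⁆⁆ := leibniz_lie _ _ _
    rw [BE2, dU, smul_lie, E2U, EX] at h
    rw [hV, lie_sub, lie_smul, BX1, h]; module
  have EV : ⁅E, V⁆ = (l - 4 * α) • V - ⁅U, X⁆ := by
    have h : ⁅E, ⁅E2, X⁆⁆ = ⁅⁅E, E2⁆, X⁆ + ⁅E2, ⁅E, X⁆⁆ := leibniz_lie _ _ _
    rw [EE2, EX, lie_smul, sub_lie, smul_lie, E2X] at h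
    rw [hV, lie_sub, lie_smul, EX1', E2X, h]; module
  -- action of `Y`
  have YA : ⁅Y, A⁆ = 0 := by rw [← lie_skew, r6, neg_zero]
  have YB : ⁅Y, B⁆ = ⁅A, ⁅A, X⁆⁆ := by
    rw [← lie_skew]; linear_combination (norm := module) -r5
  have YE : ⁅Y, E⁆ = ⁅A, ⁅A, ⁅A, X⁆⁆⁆ := by
    rw [← dE, leibniz_lie, YA, YB, zero_lie, zero_add]
  have YE3 : ⁅Y, E3⁆ = (40 * α - 5 * l - 4 * α) • ⁅A, ⁅A, X⁆⁆ + (5 : K) • ⁅A, V⁆ := by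
    rw [← dE3, leibniz_lie, YB, YE, ← lie_skew, EX2, Ba, BX2, EX2, lie_add, lie_smul]; module
  have YR1 : ⁅Y, ⁅B, E3⁆⁆ = ⁅⁅Y, B⁆, E3⁆ + ⁅B, ⁅Y, E3⁆⁆ := leibniz_lie _ _ _
  rw [r1, lie_zero, YB, YE3, ← lie_skew, red _ Z1X2, lie_add, lie_smul, lie_smul, BX2, Ba V, BV,
    lie_zero, EV] at YR1
  have key := congrArg (fun m => ⁅B, m⁆) YR1
  have BUX : ⁅B, ⁅U, X⁆⁆ = 0 := by rw [leibniz_lie, r3, dU]; simp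
  simp only [lie_add, lie_smul, lie_sub, lie_neg, lie_zero, BX1, BV, BUX] at key
  have fin : (30 * (8 * α - l) * (4 * α - l) * (2 * α - l)) • X = 0 := by
    linear_combination (norm := module) -key
  have := smul_eq_zero.1 fin
  rcases this with h | h
  · exfalso
    revert h
    simp [h1, h2, h3]
  · exact h

set_option maxHeartbeats 1000000 in
theorem we_struct {K L : Type*} [Field K] [CharZero K] [LieRing L] [LieAlgebra K L]
    (α : K) (hα : α ≠ 0)
    (A B Y E E2 E3 : L) (dE : ⁅A, B⁆ = E) (dE2 : ⁅A, E⁆ = E2) (dE3 : ⁅B, E⁆ = E3)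
    (dX : ⁅A, E2⁆ = 0)
    (r1 : ⁅B, E3⁆ = 0) (r2 : (4 * α) • E + ⁅A, E3⁆ = 0)
    (r5 : ⁅B, Y⁆ = 0) (r6 : ⁅A, Y⁆ = 0)
    (hgen : ∀ T : LieSubalgebra K L, A ∈ T → B ∈ T → Y ∈ T → T = ⊤)
    (f : L →ₗ⁅K⁆ LieAlgebra.SpecialLinear.sl (Fin 2) K)
    (fA : (f A).val = !![0, 1 / (4 * α); 0, 0]) (fB : (f B).val = !![0, 0; -8 * α ^ 2, 0])
    (fY : f Y = 0)
    (g : L →ₗ[K] (Fin 3 → K)) (gA : g A = ![1, 0, 0]) (gB : g B = ![0, 1, 0])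
    (gY : g Y = ![0, 0, 1]) (gbr : ∀ x y : L, g ⁅x, y⁆ = 0) :
    ∃ S T : LieSubalgebra K L,
      Nonempty (S ≃ₗ⁅K⁆ LieAlgebra.SpecialLinear.sl (Fin 2) K) ∧
      IsLieAbelian T ∧
      Module.finrank K T = 3 ∧
      IsCompl S.toSubmodule T.toSubmodule ∧
      (∀ s ∈ S, ∀ a ∈ T, ⁅s, a⁆ = 0) ∧
      S.toSubmodule = Submodule.span K {E, E2, E3} ∧
      T.toSubmodule = Submodule.span K {Y, (-(4 * α)) • A + E2, (4 * α) • B + E3} := by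
  have e1 : ∀ m : L, ⁅E, m⁆ = ⁅A, ⁅B, m⁆⁆ - ⁅B, ⁅A, m⁆⁆ := fun m => by rw [← dE, lie_lie]
  have e2 : ∀ m : L, ⁅E2, m⁆ = ⁅A, ⁅E, m⁆⁆ - ⁅E, ⁅A, m⁆⁆ := fun m => by rw [← dE2, lie_lie]
  have e3 : ∀ m : L, ⁅E3, m⁆ = ⁅B, ⁅E, m⁆⁆ - ⁅E, ⁅B, m⁆⁆ := fun m => by rw [← dE3, lie_lie]
  have AE3 : ⁅A, E3⁆ = -(4 * α) • E := by linear_combination (norm := module) r2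
  have BE2 : ⁅B, E2⁆ = -(4 * α) • E := by
    have := e1 E
    rw [lie_self, dE3, dE2, AE3] at this
    linear_combination (norm := module) this
  have EE2 : ⁅E, E2⁆ = -(4 * α) • E2 := by rw [e1, BE2, dX, lie_smul, dE2, lie_zero, sub_zero]
  have EE3 : ⁅E, E3⁆ = (4 * α) • E3 := by rw [e1, r1, AE3, lie_smul, dE3, lie_zero]; module
  have E23 : ⁅E2, E3⁆ = -(16 * α ^ 2) • E := by
    rw [e2, EE3, AE3, lie_smul, lie_smul, lie_self, AE3]; module
  have E2E : ⁅E2, E⁆ = (4 * α) • E2 := by rw [← lie_skew, EE2]; module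
  have E3E : ⁅E3, E⁆ = -(4 * α) • E3 := by rw [← lie_skew, EE3]; module
  have E32 : ⁅E3, E2⁆ = (16 * α ^ 2) • E := by rw [← lie_skew, E23]; module
  have EA : ⁅E, A⁆ = -E2 := by rw [← lie_skew, dE2]
  have EB : ⁅E, B⁆ = -E3 := by rw [← lie_skew, dE3]
  have E2A : ⁅E2, A⁆ = 0 := by rw [← lie_skew, dX, neg_zero]
  have E3B : ⁅E3, B⁆ = 0 := by rw [← lie_skew, r1, neg_zero]
  have E2B : ⁅E2, B⁆ = (4 * α) • E := by rw [← lie_skew, BE2]; module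
  have E3A : ⁅E3, A⁆ = (4 * α) • E := by rw [← lie_skew, AE3]; module
  have BA : ⁅B, A⁆ = -E := by rw [← lie_skew, dE]
  have EY : ⁅E, Y⁆ = 0 := by rw [e1, r5, r6]; simp
  have E2Y : ⁅E2, Y⁆ = 0 := by rw [e2, EY, r6]; simp
  have E3Y : ⁅E3, Y⁆ = 0 := by rw [e3, EY, r5]; simp
  have YA : ⁅Y, A⁆ = 0 := by rw [← lie_skew, r6, neg_zero]
  have YB : ⁅Y, B⁆ = 0 := by rw [← lie_skew, r5, neg_zero]
  have YE2 : ⁅Y, E2⁆ = 0 := by rw [← lie_skew, E2Y, neg_zero]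
  have YE3 : ⁅Y, E3⁆ = 0 := by rw [← lie_skew, E3Y, neg_zero]
  have memS : ∀ x : L, x ∈ Submodule.span K {E, E2, E3} ↔
      ∃ a b c : K, x = a • E + b • E2 + c • E3 := fun x => by
    simp only [Submodule.mem_span_insert, Submodule.mem_span_singleton]
    constructor
    · rintro ⟨a, _, ⟨b, _, ⟨c, rfl⟩, rfl⟩, rfl⟩
      exact ⟨a, b, c, by abel⟩
    · rintro ⟨a, b, c, rfl⟩
      exact ⟨a, _, ⟨b, _, ⟨c, rfl⟩, rfl⟩, by abel⟩
  have memT : ∀ x : L, x ∈ Submodule.span K {Y, (-(4 * α)) • A + E2, (4 * α) • B + E3} ↔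
      ∃ a b c : K, x = a • Y + b • ((-(4 * α)) • A + E2) + c • ((4 * α) • B + E3) := fun x => by
    simp only [Submodule.mem_span_insert, Submodule.mem_span_singleton]
    constructor
    · rintro ⟨a, _, ⟨b, _, ⟨c, rfl⟩, rfl⟩, rfl⟩
      exact ⟨a, b, c, by abel⟩
    · rintro ⟨a, b, c, rfl⟩
      exact ⟨a, _, ⟨b, _, ⟨c, rfl⟩, rfl⟩, by abel⟩
  have TT : ∀ x y : L, x ∈ Submodule.span K {Y, (-(4 * α)) • A + E2, (4 * α) • B + E3} →
      y ∈ Submodule.span K {Y, (-(4 * α)) • A + E2, (4 * α) • B + E3} → ⁅x, y⁆ = 0 := by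
    intro x y hx hy
    obtain ⟨a, b, c, rfl⟩ := (memT x).1 hx
    obtain ⟨a', b', c', rfl⟩ := (memT y).1 hy
    simp only [add_lie, lie_add, smul_lie, lie_smul, lie_self, dE, BA, dX, AE3, BE2, r1, r5, r6,
      E23, E32, E2A, E2B, E3A, E3B, E2Y, E3Y, YA, YB, YE2, YE3]
    module
  have ST : ∀ x y : L, x ∈ Submodule.span K {E, E2, E3} →
      y ∈ Submodule.span K {Y, (-(4 * α)) • A + E2, (4 * α) • B + E3} → ⁅x, y⁆ = 0 := by
    intro x y hx hy
    obtain ⟨a, b, c, rfl⟩ := (memS x).1 hx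
    obtain ⟨a', b', c', rfl⟩ := (memT y).1 hy
    simp only [add_lie, lie_add, smul_lie, lie_smul, lie_self, EA, EB, EE2, EE3, EY,
      E23, E32, E2A, E2B, E3A, E3B, E2Y, E3Y]
    module
  let S : LieSubalgebra K L := { Submodule.span K {E, E2, E3} with
    lie_mem' := by
      intro x y hx hy
      obtain ⟨a, b, c, rfl⟩ := (memS x).1 hx
      obtain ⟨a', b', c', rfl⟩ := (memS y).1 hy
      refine (memS _).2 ⟨-(16 * α ^ 2) * (b * c' - c * b'), -(4 * α) * (a * b' - b * a'),
        (4 * α) * (a * c' - c * a'), ?_⟩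
      simp only [add_lie, lie_add, smul_lie, lie_smul, lie_self, EE2, EE3, E2E, E3E, E23, E32]
      module }
  let T : LieSubalgebra K L :=
    { Submodule.span K {Y, (-(4 * α)) • A + E2, (4 * α) • B + E3} with
      lie_mem' := by
        intro x y hx hy
        rw [TT x y hx hy]
        exact Submodule.zero_mem _ }
  have hS : S.toSubmodule = Submodule.span K {E, E2, E3} := rfl
  have hT : T.toSubmodule =
    Submodule.span K {Y, (-(4 * α)) • A + E2, (4 * α) • B + E3} := rfl
  have memS' : ∀ x : L, x ∈ S ↔ ∃ a b c : K, x = a • E + b • E2 + c • E3 := memS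
  have memT' : ∀ x : L, x ∈ T ↔ ∃ a b c : K,
    x = a • Y + b • ((-(4 * α)) • A + E2) + c • ((4 * α) • B + E3) := memT
  -- values of `f`
  have fE : (f E).val = !![-(2 * α), 0; 0, 2 * α] := by
    rw [← dE, LieHom.map_lie, LieAlgebra.SpecialLinear.sl_bracket, fA, fB]
    ext i j
    fin_cases i <;> fin_cases j <;> simp <;> field_simp <;> norm_num
  have fE2 : (f E2).val = !![0, 1; 0, 0] := by
    rw [← dE2, LieHom.map_lie, LieAlgebra.SpecialLinear.sl_bracket, fA, fE]
    ext i j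
    fin_cases i <;> fin_cases j <;> simp <;> field_simp <;> norm_num
  have fE3 : (f E3).val = !![0, 0; 32 * α ^ 3, 0] := by
    rw [← dE3, LieHom.map_lie, LieAlgebra.SpecialLinear.sl_bracket, fB, fE]
    ext i j
    fin_cases i <;> fin_cases j <;> simp <;> ring
  have fS : ∀ a b c : K, (f (a • E + b • E2 + c • E3)).val =
      !![-(2 * α) * a, b; 32 * α ^ 3 * c, 2 * α * a] := by
    intro a b c
    have : (f (a • E + b • E2 + c • E3)).val = a • (f E).val + b • (f E2).val + c • (f E3).val := by
      simp
    rw [this, fE, fE2, fE3]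
    ext i j
    fin_cases i <;> fin_cases j <;> simp <;> ring
  have inj : ∀ x ∈ S, f x = 0 → x = 0 := by
    intro x hx h0
    obtain ⟨a, b, c, rfl⟩ := (memS x).1 hx
    have h := fS a b c
    rw [h0] at h
    have h00 := congrFun (congrFun h 1) 1
    have h01 := congrFun (congrFun h 0) 1
    have h10 := congrFun (congrFun h 1) 0
    simp [hα] at h00 h01 h10
    simp [h00, ← h01, h10]
  have fZ0 : f ((-(4 * α)) • A + E2) = 0 := by
    apply Subtype.ext
    have : (f ((-(4 * α)) • A + E2)).val = (-(4 * α)) • (f A).val + (f E2).val := by simp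
    rw [this, fA, fE2]
    ext i j
    fin_cases i <;> fin_cases j <;> simp
    field_simp
    norm_num
  have fZ1 : f ((4 * α) • B + E3) = 0 := by
    apply Subtype.ext
    have : (f ((4 * α) • B + E3)).val = (4 * α) • (f B).val + (f E3).val := by simp
    rw [this, fB, fE3]
    ext i j
    fin_cases i <;> fin_cases j <;> simp
    ring
  have fT : ∀ x ∈ T, f x = 0 := by
    intro x hx
    obtain ⟨a, b, c, rfl⟩ := (memT x).1 hx
    rw [map_add, map_add, map_smul, map_smul, map_smul,
      fY, fZ0, fZ1]
    simp
  -- values of `g`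
  have gE2 : g E2 = 0 := by rw [← dE2, gbr]
  have gE3 : g E3 = 0 := by rw [← dE3, gbr]
  have gT : ∀ a b c : K, g (a • Y + b • ((-(4 * α)) • A + E2) + c • ((4 * α) • B + E3)) =
      ![b * (-(4 * α)), c * (4 * α), a] := by
    intro a b c
    simp only [map_add, map_smul, gA, gB, gY, gE2, gE3]
    ext i
    fin_cases i <;> simp
  have hST : S.toSubmodule ⊔ T.toSubmodule = ⊤ := by
    let R : LieSubalgebra K L := { S.toSubmodule ⊔ T.toSubmodule with
      lie_mem' := by
        intro x y hx hy
        obtain ⟨s, hs, t, ht, rfl⟩ := Submodule.mem_sup.1 hx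
        obtain ⟨s', hs', t', ht', rfl⟩ := Submodule.mem_sup.1 hy
        have h1 : ⁅s, t'⁆ = 0 := ST s t' hs ht'
        have h2 : ⁅t, s'⁆ = 0 := by rw [← lie_skew, ST s' t hs' ht, neg_zero]
        have h3 : ⁅t, t'⁆ = 0 := TT t t' ht ht'
        rw [add_lie, lie_add, lie_add, h1, h2, h3, add_zero, add_zero, add_zero]
        exact Submodule.mem_sup_left (S.lie_mem hs hs') }
    have hR : R.toSubmodule = S.toSubmodule ⊔ T.toSubmodule := rfl
    rw [← hR, hgen R, LieSubalgebra.top_toSubmodule]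
    · refine Submodule.mem_sup.2 ⟨(1 / (4 * α)) • E2, (memS _).2 ⟨0, 1 / (4 * α), 0, by module⟩,
        (-(1 / (4 * α))) • ((-(4 * α)) • A + E2), (memT _).2 ⟨0, -(1 / (4 * α)), 0, by module⟩, ?_⟩
      match_scalars <;> field_simp <;> ring
    · refine Submodule.mem_sup.2 ⟨(-(1 / (4 * α))) • E3, (memS _).2 ⟨0, 0, -(1 / (4 * α)), by module⟩,
        (1 / (4 * α)) • ((4 * α) • B + E3), (memT _).2 ⟨0, 0, 1 / (4 * α), by module⟩, ?_⟩
      match_scalars <;> field_simp <;> ring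
    · exact Submodule.mem_sup_right ((memT _).2 ⟨1, 0, 0, by module⟩)
  refine ⟨S, T, ?_, ?_, ?_, ?_, fun s hs a ha => ST s a hs ha, hS, hT⟩
  · refine ⟨LieEquiv.ofBijective (f.comp S.incl) ⟨?_, ?_⟩⟩
    · rw [injective_iff_map_eq_zero]
      intro x hx
      exact Subtype.ext (inj x.1 x.2 hx)
    · intro M
      have htr : M.val 0 0 + M.val 1 1 = 0 := by
        have h : Matrix.trace M.val = 0 := M.2
        rwa [Matrix.trace_fin_two] at h
      refine ⟨⟨(M.val 1 1 / (2 * α)) • E + M.val 0 1 • E2 + (M.val 1 0 / (32 * α ^ 3)) • E3,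
        (memS _).2 ⟨_, _, _, rfl⟩⟩, ?_⟩
      apply Subtype.ext
      refine (fS _ _ _).trans ?_
      ext i j
      fin_cases i <;> fin_cases j <;> simp <;> field_simp
      linear_combination -htr
  · refine ⟨fun x y => Subtype.ext ?_⟩
    exact TT x.1 y.1 x.2 y.2
  · change Module.finrank K T.toSubmodule = 3
    have hli : LinearIndependent K ![Y, (-(4 * α)) • A + E2, (4 * α) • B + E3] := by
      rw [Fintype.linearIndependent_iff]
      intro w hw
      simp only [Fin.sum_univ_three, Matrix.cons_val] at hw
      have h := gT (w 0) (w 1) (w 2)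
      rw [hw, map_zero] at h
      have h0 := congrFun h 0
      have h1 := congrFun h 1
      have h2 := congrFun h 2
      simp [hα] at h0 h1 h2
      intro i
      fin_cases i
      · exact h2.symm
      · exact h0
      · exact h1
    have hr : Set.range ![Y, (-(4 * α)) • A + E2, (4 * α) • B + E3] =
        {Y, (-(4 * α)) • A + E2, (4 * α) • B + E3} := by
      simp only [Matrix.range_cons, Matrix.range_empty, Set.union_empty, Set.singleton_union]
    rw [hT, ← hr, finrank_span_eq_card hli, Fintype.card_fin]
  · refine ⟨?_, codisjoint_iff.2 hST⟩
    rw [Submodule.disjoint_def]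
    intro x hx hx'
    exact inj x hx (fT x hx')

set_option linter.unusedSectionVars false

theorem wePr_lie (x y : FreeLieAlgebra K (Fin 3)) :
    wePr K α β ⁅x, y⁆ = ⁅wePr K α β x, wePr K α β y⁆ := rfl

theorem wePr_add (x y : FreeLieAlgebra K (Fin 3)) :
    wePr K α β (x + y) = wePr K α β x + wePr K α β y := rfl

theorem wePr_sub (x y : FreeLieAlgebra K (Fin 3)) :
    wePr K α β (x - y) = wePr K α β x - wePr K α β y := rfl

theorem wePr_smul (c : K) (x : FreeLieAlgebra K (Fin 3)) :
    wePr K α β (c • x) = c • wePr K α β x := rfl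

theorem wePr_rel (x : FreeLieAlgebra K (Fin 3)) (hx : x ∈ weRelations K α β) :
    wePr K α β x = 0 :=
  LieSubmodule.Quotient.mk_eq_zero'.2 (LieSubmodule.subset_lieSpan hx)

/-- The projection as a Lie algebra homomorphism. -/
def wePrHom : FreeLieAlgebra K (Fin 3) →ₗ⁅K⁆ WEAlgebra K α β where
  toFun := wePr K α β
  map_add' _ _ := rfl
  map_smul' _ _ := rfl
  map_lie' := rfl

/-- Universal property of the presented algebra. -/
theorem we_lift {M : Type*} [LieRing M] [LieAlgebra K M]
    (F : FreeLieAlgebra K (Fin 3) →ₗ⁅K⁆ M) (hF : ∀ x ∈ weRelations K α β, F x = 0) :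
    ∃ G : WEAlgebra K α β →ₗ⁅K⁆ M, ∀ x, G (wePr K α β x) = F x := by
  have hle : weIdeal K α β ≤ F.ker :=
    LieSubmodule.lieSpan_le.2 fun x hx => (LieHom.mem_ker).2 (hF x hx)
  let G : WEAlgebra K α β →ₗ[K] M :=
    Submodule.liftQ (weIdeal K α β).toSubmodule (F : FreeLieAlgebra K (Fin 3) →ₗ[K] M)
      (fun x hx => LinearMap.mem_ker.2 ((LieHom.mem_ker).1 (hle hx)))
  have hG : ∀ x, G (wePr K α β x) = F x := fun x => rfl
  refine ⟨{ G with map_lie' := ?_ }, hG⟩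
  intro x y
  obtain ⟨x, rfl⟩ := LieSubmodule.Quotient.surjective_mk' _ x
  obtain ⟨y, rfl⟩ := LieSubmodule.Quotient.surjective_mk' _ y
  exact F.map_lie x y

section Abelianization

attribute [local instance] LieRing.ofAssociativeRing

/-- The abelianization map onto `K³`. -/
theorem we_ab : ∃ g : WEAlgebra K α β →ₗ[K] (Fin 3 → K),
    g (wePr K α β (genA₀ K)) = ![1, 0, 0] ∧ g (wePr K α β (genA₁ K)) = ![0, 1, 0] ∧
    g (wePr K α β (genY K)) = ![0, 0, 1] ∧
    ∀ x y : WEAlgebra K α β, g ⁅x, y⁆ = 0 := by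
  have hD : ∀ u v : Fin 3 → K, ⁅u, v⁆ = 0 := by
    intro u v
    rw [LieRing.of_associative_ring_bracket, mul_comm, sub_self]
  obtain ⟨g, hg⟩ := we_lift K α β (M := Fin 3 → K)
    (FreeLieAlgebra.lift K ![![1, 0, 0], ![0, 1, 0], ![0, 0, 1]]) (by
    rintro x (rfl | rfl | rfl | rfl | rfl | rfl) <;>
      simp only [LieHom.map_lie, map_add, map_sub, map_smul, hD, smul_zero,
        add_zero, sub_zero])
  refine ⟨(g : WEAlgebra K α β →ₗ[K] (Fin 3 → K)), ?_, ?_, ?_, ?_⟩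
  · refine (hg _).trans ?_
    rw [genA₀, FreeLieAlgebra.lift_of_apply]
    rfl
  · refine (hg _).trans ?_
    rw [genA₁, FreeLieAlgebra.lift_of_apply]
    rfl
  · refine (hg _).trans ?_
    rw [genY, FreeLieAlgebra.lift_of_apply]
    rfl
  · intro x y
    exact (LieHom.map_lie g x y).trans (hD _ _)

end Abelianization

theorem we_gen (T : LieSubalgebra K (WEAlgebra K α β)) (h0 : wePr K α β (genA₀ K) ∈ T)
    (h1 : wePr K α β (genA₁ K) ∈ T) (h2 : wePr K α β (genY K) ∈ T) : T = ⊤ := by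
  let F : FreeLieAlgebra K (Fin 3) →ₗ⁅K⁆ T := FreeLieAlgebra.lift K
    ![⟨_, h0⟩, ⟨_, h1⟩, ⟨_, h2⟩]
  have hF : T.incl.comp F = wePrHom K α β := by
    apply FreeLieAlgebra.hom_ext
    intro i
    rw [LieHom.comp_apply, FreeLieAlgebra.lift_of_apply]
    fin_cases i <;> rfl
  rw [eq_top_iff]
  intro x _
  obtain ⟨x, rfl⟩ := LieSubmodule.Quotient.surjective_mk' _ x
  have := congrArg (fun f => f x) hF
  have h : wePr K α β x = (F x).1 := this.symm
  change wePr K α β x ∈ T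
  rw [h]
  exact (F x).2

/-- For `α ≠ 0` with `(α+β)(6α+β)(16α+β) ≠ 0`, the presented Lie algebra
`𝔥(α,β)` is the direct sum of a copy of `sl₂(K)`, spanned by the images of
`E₁ = [A₀,A₁]`, `E₂ = [A₀,[A₀,A₁]]`, `E₃ = [A₁,[A₀,A₁]]`, and a 3-dimensional abelian
Lie algebra spanned by the images of `Y`, `Z₀ = −4αA₀ + [A₀,[A₀,A₁]]`,
`Z₁ = 4αA₁ + [A₁,[A₀,A₁]]`. -/
theorem stmt_10 (hα : α ≠ 0)
    (hne : (α + β) * (6 * α + β) * (16 * α + β) ≠ 0) :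
    ∃ S A : LieSubalgebra K (WEAlgebra K α β),
      Nonempty (S ≃ₗ⁅K⁆ LieAlgebra.SpecialLinear.sl (Fin 2) K) ∧
      IsLieAbelian A ∧
      Module.finrank K A = 3 ∧
      IsCompl S.toSubmodule A.toSubmodule ∧
      (∀ s ∈ S, ∀ a ∈ A, ⁅s, a⁆ = 0) ∧
      S.toSubmodule = Submodule.span K
        { wePr K α β ⁅genA₀ K, genA₁ K⁆,
          wePr K α β ⁅genA₀ K, ⁅genA₀ K, genA₁ K⁆⁆,
          wePr K α β ⁅genA₁ K, ⁅genA₀ K, genA₁ K⁆⁆ } ∧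
      A.toSubmodule = Submodule.span K
        { wePr K α β (genY K),
          wePr K α β ((-(4 * α)) • genA₀ K + ⁅genA₀ K, ⁅genA₀ K, genA₁ K⁆⁆),
          wePr K α β ((4 * α) • genA₁ K + ⁅genA₁ K, ⁅genA₀ K, genA₁ K⁆⁆) } := by
  have hR := wePr_rel K α β
  have h8 : 8 * α - (8 * α - 2 * β) / 5 ≠ 0 := fun h => hne (by
    have : 16 * α + β = 0 := by linear_combination 5 / 2 * h
    rw [this, mul_zero])
  have h4 : 4 * α - (8 * α - 2 * β) / 5 ≠ 0 := fun h => hne (by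
    have : 6 * α + β = 0 := by linear_combination 5 / 2 * h
    rw [this, mul_zero, zero_mul])
  have h2 : 2 * α - (8 * α - 2 * β) / 5 ≠ 0 := fun h => hne (by
    have : α + β = 0 := by linear_combination 5 / 2 * h
    rw [this, zero_mul, zero_mul])
  have hβ : β = 4 * α - 5 / 2 * ((8 * α - 2 * β) / 5) := by ring
  have R1 := hR _ (Or.inl rfl)
  have R2 := hR _ (Or.inr (Or.inl rfl))
  have R3 := hR _ (Or.inr (Or.inr (Or.inl rfl)))
  have R4 := hR _ (Or.inr (Or.inr (Or.inr (Or.inl rfl))))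
  have R5 := hR _ (Or.inr (Or.inr (Or.inr (Or.inr (Or.inl rfl)))))
  have R6 := hR _ (Or.inr (Or.inr (Or.inr (Or.inr (Or.inr rfl)))))
  simp only [wePr_lie, wePr_add, wePr_sub, wePr_smul] at R1 R2 R3 R4 R5 R6 ⊢
  generalize hA : wePr K α β (genA₀ K) = A at *
  generalize hB : wePr K α β (genA₁ K) = B at *
  generalize hY : wePr K α β (genY K) = Y at *
  have hX : ⁅A, ⁅A, ⁅A, B⁆⁆⁆ = 0 := by
    refine weX_zero α ((8 * α - 2 * β) / 5) h8 h4 h2 A B Y _ _ _ _ _ rfl rfl rfl rfl rfl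
      R1 R2 R3 ?_ R5 R6
    rw [← hβ]
    exact R4
  have hBY : ⁅B, Y⁆ = 0 := by
    rw [hX, lie_zero, lie_zero, add_zero] at R5
    exact R5
  -- the homomorphism to `sl₂`
  obtain ⟨f, hf⟩ := we_lift K α β (M := LieAlgebra.SpecialLinear.sl (Fin 2) K)
    (FreeLieAlgebra.lift K ![LieAlgebra.SpecialLinear.single 0 1 (by decide) (1 / (4 * α)),
      LieAlgebra.SpecialLinear.single 1 0 (by decide) (-8 * α ^ 2), 0]) (by
    have hE : ∀ a b : K, (⁅LieAlgebra.SpecialLinear.single (0 : Fin 2) 1 (by decide) a,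
        LieAlgebra.SpecialLinear.single (1 : Fin 2) 0 (by decide) b⁆ :
        LieAlgebra.SpecialLinear.sl (Fin 2) K) =
        LieAlgebra.SpecialLinear.singleSubSingle 0 1 (a * b) := by
      intro a b
      apply Subtype.ext
      rw [LieAlgebra.SpecialLinear.sl_bracket]
      ext i j
      fin_cases i <;> fin_cases j <;> simp [mul_comm]
    have hAE : ∀ a b : K, (⁅LieAlgebra.SpecialLinear.single (0 : Fin 2) 1 (by decide) a,
        LieAlgebra.SpecialLinear.singleSubSingle (0 : Fin 2) 1 b⁆ :
        LieAlgebra.SpecialLinear.sl (Fin 2) K) =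
        LieAlgebra.SpecialLinear.single (0 : Fin 2) 1 (by decide) (-2 * a * b) := by
      intro a b
      apply Subtype.ext
      rw [LieAlgebra.SpecialLinear.sl_bracket]
      ext i j
      fin_cases i <;> fin_cases j <;> simp [sub_mul, mul_sub] <;> ring
    have hBE : ∀ a b : K, (⁅LieAlgebra.SpecialLinear.single (1 : Fin 2) 0 (by decide) a,
        LieAlgebra.SpecialLinear.singleSubSingle (0 : Fin 2) 1 b⁆ :
        LieAlgebra.SpecialLinear.sl (Fin 2) K) =
        LieAlgebra.SpecialLinear.single (1 : Fin 2) 0 (by decide) (2 * a * b) := by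
      intro a b
      apply Subtype.ext
      rw [LieAlgebra.SpecialLinear.sl_bracket]
      ext i j
      fin_cases i <;> fin_cases j <;> simp [sub_mul, mul_sub] <;> ring
    have hAA : ∀ a b : K, (⁅LieAlgebra.SpecialLinear.single (0 : Fin 2) 1 (by decide) a,
        LieAlgebra.SpecialLinear.single (0 : Fin 2) 1 (by decide) b⁆ :
        LieAlgebra.SpecialLinear.sl (Fin 2) K) = 0 := by
      intro a b
      apply Subtype.ext
      rw [LieAlgebra.SpecialLinear.sl_bracket]
      ext i j
      fin_cases i <;> fin_cases j <;> simp
    have hBB : ∀ a b : K, (⁅LieAlgebra.SpecialLinear.single (1 : Fin 2) 0 (by decide) a,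
        LieAlgebra.SpecialLinear.single (1 : Fin 2) 0 (by decide) b⁆ :
        LieAlgebra.SpecialLinear.sl (Fin 2) K) = 0 := by
      intro a b
      apply Subtype.ext
      rw [LieAlgebra.SpecialLinear.sl_bracket]
      ext i j
      fin_cases i <;> fin_cases j <;> simp
    rintro x (rfl | rfl | rfl | rfl | rfl | rfl) <;>
      simp only [LieHom.map_lie, map_add, map_sub, map_smul, genA₀, genA₁, genY,
        FreeLieAlgebra.lift_of_apply, Matrix.cons_val, hE, hAE, hBE, hAA, hBB, lie_zero, smul_zero,
        add_zero, sub_zero]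
    rw [← map_smul, ← map_add]
    refine (congrArg (LieAlgebra.SpecialLinear.singleSubSingle (R := K) (0 : Fin 2) 1) ?_).trans
      (map_zero _)
    simp only [smul_eq_mul]
    field_simp
    ring)
  obtain ⟨g, gA, gB, gY, gbr⟩ := we_ab K α β
  refine we_struct α hα A B Y _ _ _ rfl rfl rfl hX R1 R2 hBY R6 ?_ f ?_ ?_ ?_ g ?_ ?_ ?_ ?_
  · rw [← hA, ← hB, ← hY]
    exact we_gen K α β
  · rw [← hA, hf, genA₀, FreeLieAlgebra.lift_of_apply]
    ext i j
    fin_cases i <;> fin_cases j <;> simp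
  · rw [← hB, hf, genA₁, FreeLieAlgebra.lift_of_apply]
    ext i j
    fin_cases i <;> fin_cases j <;> simp
  · rw [← hY, hf, genY, FreeLieAlgebra.lift_of_apply]
    rfl
  · rw [← hA, gA]
  · rw [← hB, gB]
  · rw [← hY, gY]
  · exact gbr

end
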